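/- Let G be a countably infinite discrete amenable group acting continuously on a compact Hausdorff space X, let {F_n} be a tempered Følner sequence in G, and let 𝒰 be a finite open cover of X. If s > 0 satisfies ℳ(X,𝒰,s,{F_n}) = 0, then h_top(G,𝒰) ≤ s, where h_top(G,𝒰) = lim_{n→∞} (1/|F_n|) log N(⋁_{g∈F_n} g^{-1}𝒰). Consequently h^B_top(𝒰,X,{F_n}) ≥ h_top(G,𝒰). -/

import Mathlib

/-!
Bowen (dimensional) topological entropy for actions of countably infinite amenable groups,
and the theorem that it equals the usual topological entropy along any tempered Følner
sequence (Theorem 1.1 of Dou–Zhang).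
-/

open Filter Topology Pointwise Set
open scoped ENNReal NNReal

section Defs

variable {G : Type*} [Group G] [DecidableEq G]

/-- `F` is a (left) Følner sequence: each `F n` is nonempty and
`|F n ∆ gF n| / |F n| → 0` for every `g ∈ G`. -/
def IsFolnerSeq (F : ℕ → Finset G) : Prop :=
  (∀ n, (F n).Nonempty) ∧
    ∀ g : G, Filter.Tendsto
      (fun n => ((symmDiff (F n) ((F n).image (fun h => g * h))).card : ℝ) / ((F n).card : ℝ))
      Filter.atTop (nhds 0)

/-- `F` is tempered: there is `C > 0` with `|⋃_{k<n} (F k)⁻¹ (F n)| ≤ C |F n|` for all `n`. -/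
def IsTemperedSeq (F : ℕ → Finset G) : Prop :=
  ∃ C : ℝ, 0 < C ∧ ∀ n : ℕ,
    ((((Finset.range n).biUnion fun k => (F k)⁻¹ * F n)).card : ℝ) ≤ C * ((F n).card : ℝ)

variable {X : Type*} [TopologicalSpace X] [MulAction G X]

/-- The set `X(U) = ⋂_{g ∈ F} g⁻¹ U_g` associated to a `(𝒰,F)`-name `u`. -/
def nameSet (F : Finset G) (u : G → Set X) : Set X := {x : X | ∀ g ∈ F, g • x ∈ u g}

/-- `𝒰` is a finite open cover of the set `Z`. -/
def IsFiniteOpenCoverOn (𝒰 : Finset (Set X)) (Z : Set X) : Prop :=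
  (∀ V ∈ 𝒰, IsOpen V) ∧ Z ⊆ ⋃₀ (𝒰 : Set (Set X))

/-- `N(⋁_{g ∈ F} g⁻¹ 𝒰)` relative to `Z` : the minimal cardinality of a family of
`(𝒰,F)`-names whose associated sets cover `Z`. -/
noncomputable def covNum (𝒰 : Finset (Set X)) (F : Finset G) (Z : Set X) : ℕ :=
  sInf {k : ℕ | ∃ Λ : Finset (G → Set X), Λ.card = k ∧
    (∀ u ∈ Λ, ∀ g ∈ F, u g ∈ 𝒰) ∧ Z ⊆ ⋃ u ∈ Λ, nameSet F u}

/-- The entropy of the cover `𝒰` along the Følner sequence `Fseq`,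
`lim_n (1/|F n|) log N(⋁_{g ∈ F n} g⁻¹𝒰)` (the limit exists by the Ornstein–Weiss lemma,
so we may express it as a `limsup`). -/
noncomputable def coverEntropyOf (Fseq : ℕ → Finset G) (𝒰 : Finset (Set X)) (Z : Set X) :
    ℝ≥0∞ :=
  Filter.limsup
    (fun n => ENNReal.ofReal (Real.log (covNum 𝒰 (Fseq n) Z) / ((Fseq n).card : ℝ)))
    Filter.atTop

/-- The topological entropy `h_top(X,G) = sup_𝒰 lim_n (1/|F n|) log N(⋁_{g∈F n} g⁻¹𝒰)`,
the supremum over all finite open covers `𝒰` of `X`. -/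
noncomputable def topEntropy (X : Type*) [TopologicalSpace X] [MulAction G X]
    (Fseq : ℕ → Finset G) : ℝ≥0∞ :=
  ⨆ (𝒰 : Finset (Set X)) (_ : IsFiniteOpenCoverOn 𝒰 (Set.univ : Set X)),
    coverEntropyOf Fseq 𝒰 (Set.univ : Set X)

/-- `ℳ(Z,𝒰,N,s,{F n})`: the infimum of `∑_{U ∈ Λ} exp(-s·m(U))` over all collections `Λ`
of `(𝒰, F j)`-names with `j ≥ N` whose associated sets cover `Z`. -/
noncomputable def bowenM (Fseq : ℕ → Finset G) (𝒰 : Finset (Set X)) (Z : Set X)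
    (N : ℕ) (s : ℝ) : ℝ≥0∞ :=
  ⨅ (Λ : Set (ℕ × (G → Set X)))
    (_ : ∀ p ∈ Λ, N ≤ p.1 ∧ ∀ g ∈ Fseq p.1, p.2 g ∈ 𝒰)
    (_ : Z ⊆ ⋃ p ∈ Λ, nameSet (Fseq p.1) p.2),
    ∑' p : Λ, ENNReal.ofReal (Real.exp (-s * ((Fseq p.1.1).card : ℝ)))

/-- `ℳ(Z,𝒰,s,{F n}) = lim_{N→∞} ℳ(Z,𝒰,N,s,{F n})`; the quantity is nondecreasing in `N`,
so the limit is the supremum. -/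
noncomputable def bowenMlim (Fseq : ℕ → Finset G) (𝒰 : Finset (Set X)) (Z : Set X)
    (s : ℝ) : ℝ≥0∞ :=
  ⨆ N : ℕ, bowenM Fseq 𝒰 Z N s

/-- `h^B_top(𝒰,Z,{F n}) = inf {s ≥ 0 : ℳ(Z,𝒰,s,{F n}) = 0}`. -/
noncomputable def bowenEntropyCover (Fseq : ℕ → Finset G) (𝒰 : Finset (Set X)) (Z : Set X) :
    ℝ≥0∞ :=
  ⨅ (s : ℝ≥0) (_ : bowenMlim Fseq 𝒰 Z (s : ℝ) = 0), (s : ℝ≥0∞)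

/-- The Bowen (dimensional) topological entropy
`h^B_top(Z,{F n}) = sup_𝒰 h^B_top(𝒰,Z,{F n})` over finite open covers `𝒰` of `X`. -/
noncomputable def bowenEntropy (Fseq : ℕ → Finset G) (Z : Set X) : ℝ≥0∞ :=
  ⨆ (𝒰 : Finset (Set X)) (_ : IsFiniteOpenCoverOn 𝒰 (Set.univ : Set X)),
    bowenEntropyCover Fseq 𝒰 Z

end Defs

/-- Greedy selection, in order of decreasing rank, of an almost disjoint subfamily. -/
lemma exists_almost_disjoint_subfamily {ι γ : Type*} [DecidableEq ι] [DecidableEq γ]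
    (A : Finset ι) (T : ι → Finset γ) (r : ι → ℕ) {ε : ℝ} (hε : ε ≤ 1) :
    ∃ B ⊆ A, (1 - ε) * ∑ b ∈ B, ((T b).card : ℝ) ≤ ((B.biUnion T).card : ℝ) ∧
      ∀ a ∈ A, ε * ((T a).card : ℝ) ≤
        ((T a ∩ (B.filter fun b => r a ≤ r b).biUnion T).card : ℝ) := by
  refine Finset.induction_on_min_value r A ⟨∅, by simp⟩ ?_
  · intro a A ha hmin ih
    obtain ⟨B, hBA, hB, hcov⟩ := ih
    have hfil : (B.filter fun b => r a ≤ r b) = B :=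
      Finset.filter_true_of_mem fun b hb => hmin b (hBA hb)
    by_cases hbig : ε * ((T a).card : ℝ) ≤ ((T a ∩ B.biUnion T).card : ℝ)
    · refine ⟨B, hBA.trans (Finset.subset_insert _ _), hB, ?_⟩
      intro b hb
      rcases Finset.mem_insert.1 hb with rfl | hb
      · rwa [hfil]
      · exact hcov b hb
    · refine ⟨insert a B, Finset.insert_subset_insert _ hBA, ?_, ?_⟩
      · rw [Finset.sum_insert fun h => ha (hBA h), Finset.biUnion_insert]
        have h := Finset.card_union_add_card_inter (T a) (B.biUnion T)
        have h' : ((T a ∪ B.biUnion T).card : ℝ) + ((T a ∩ B.biUnion T).card : ℝ)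
            = ((T a).card : ℝ) + ((B.biUnion T).card : ℝ) := by exact_mod_cast h
        push Not at hbig
        linarith
      · intro b hb
        rcases Finset.mem_insert.1 hb with rfl | hb
        · have : T b ∩ ((insert b B).filter fun c => r b ≤ r c).biUnion T = T b := by
            refine Finset.inter_eq_left.2 (Finset.subset_biUnion_of_mem T ?_)
            simp
          rw [this]
          exact mul_le_of_le_one_left (Nat.cast_nonneg _) hε
        · refine (hcov b hb).trans ?_
          gcongr
          exact Finset.subset_insert _ _

section Tiles

variable {G : Type*} [Group G] [DecidableEq G]

/-- The right translate `F_j g` attached to `q = (g, j, a)`. -/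
def tile {α : Type*} (F : ℕ → Finset G) (q : G × ℕ × α) : Finset G :=
  (F q.2.1).image (· * q.1)

/-- The points of `E` that some element of `K` moves out of `E`. -/
def leftBoundary (K E : Finset G) : Finset G := E.filter fun g => ∃ h ∈ K, h * g ∉ E

lemma mem_image_mul_right {F : Finset G} {a h : G} : h ∈ F.image (· * a) ↔ h * a⁻¹ ∈ F := by
  simp only [Finset.mem_image]
  constructor
  · rintro ⟨b, hb, rfl⟩
    simpa using hb
  · intro hb
    exact ⟨_, hb, by simp⟩

lemma mem_image_mul_left {F : Finset G} {a h : G} : h ∈ F.image (a * ·) ↔ a⁻¹ * h ∈ F := by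
  simp only [Finset.mem_image]
  constructor
  · rintro ⟨b, hb, rfl⟩
    simpa using hb
  · intro hb
    exact ⟨_, hb, by simp⟩

lemma card_image_mul_right (F : Finset G) (a : G) : (F.image (· * a)).card = F.card :=
  Finset.card_image_of_injective _ (mul_left_injective a)

lemma mem_tile {α : Type*} {F : ℕ → Finset G} {q : G × ℕ × α} {h : G} :
    h ∈ tile F q ↔ h * q.1⁻¹ ∈ F q.2.1 :=
  mem_image_mul_right

/-- The translates `F a`, `a ∈ A`, meet `S` in at most `|F| |S|` points, with multiplicity. -/
lemma sum_card_image_mul_right_inter_le (F A S : Finset G) :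
    ∑ a ∈ A, (F.image (· * a) ∩ S).card ≤ F.card * S.card := by
  have h := Finset.sum_card_bipartiteAbove_eq_sum_card_bipartiteBelow
    (s := A) (t := S) (fun a t => t ∈ F.image (· * a))
  have h1 : ∀ a ∈ A, (F.image (· * a) ∩ S).card
      = (S.bipartiteAbove (fun a t => t ∈ F.image (· * a)) a).card := by
    intro a _
    congr 1
    ext t
    rw [Finset.mem_inter, Finset.mem_bipartiteAbove]
    tauto
  rw [Finset.sum_congr rfl h1, h, mul_comm, ← smul_eq_mul]
  refine Finset.sum_le_card_nsmul _ _ _ fun t _ => ?_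
  refine Finset.card_le_card_of_injOn (fun a => t * a⁻¹) ?_ ?_
  · intro a ha
    have := ((Finset.mem_bipartiteBelow _).1 ha).2
    exact mem_image_mul_right.1 this
  · intro a _ b _ hab
    simpa using hab

/-- A Vitali-type covering lemma for tempered sequences. -/
lemma exists_almost_disjoint_translates {F : ℕ → Finset G} (hne : ∀ n, (F n).Nonempty) {C : ℝ}
    (hC : ∀ n : ℕ, ((((Finset.range n).biUnion fun k => (F k)⁻¹ * F n)).card : ℝ)
      ≤ C * ((F n).card : ℝ))
    {ε : ℝ} (hε0 : 0 < ε) (hε : ε ≤ 1) (A : Finset G) (j : G → ℕ) :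
    ∃ B ⊆ A,
      (1 - ε) * ∑ b ∈ B, ((F (j b)).card : ℝ)
        ≤ ((B.biUnion fun b => (F (j b)).image (· * b)).card : ℝ) ∧
      (A.card : ℝ) ≤ (ε⁻¹ + C) * ∑ b ∈ B, ((F (j b)).card : ℝ) := by
  set T : G → Finset G := fun b => (F (j b)).image (· * b) with hT
  have hTc : ∀ b, (T b).card = (F (j b)).card := fun b => card_image_mul_right _ _
  obtain ⟨B, hBA, hB, hcov⟩ := exists_almost_disjoint_subfamily A T j hε
  refine ⟨B, hBA, by simpa only [hTc] using hB, ?_⟩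
  set H : Finset G := B.biUnion fun b =>
    ((Finset.range (j b)).biUnion fun k => (F k)⁻¹ * F (j b)).image (· * b)
  have hHcard : (H.card : ℝ) ≤ C * ∑ b ∈ B, ((F (j b)).card : ℝ) := by
    rw [Finset.mul_sum]
    calc (H.card : ℝ) ≤ ∑ b ∈ B,
          ((((Finset.range (j b)).biUnion fun k => (F k)⁻¹ * F (j b)).image (· * b)).card : ℝ) := by
          exact_mod_cast Finset.card_biUnion_le
      _ ≤ _ := Finset.sum_le_sum fun b _ => by
          rw [card_image_mul_right]
          exact hC (j b)
  have hpos : ∀ n, (0 : ℝ) < (F n).card := fun n => by exact_mod_cast (hne n).card_pos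
  have hlow : ∀ a ∈ A \ H, ε ≤ ∑ b ∈ B,
      if j a = j b then ((T a ∩ T b).card : ℝ) / (F (j b)).card else 0 := by
    intro a ha
    obtain ⟨haA, haH⟩ := Finset.mem_sdiff.1 ha
    have h1 : T a ∩ (B.filter fun b => j a ≤ j b).biUnion T ⊆
        (B.filter fun b => j a = j b).biUnion fun b => T a ∩ T b := by
      intro t ht
      obtain ⟨hta, ht⟩ := Finset.mem_inter.1 ht
      obtain ⟨b, hb, htb⟩ := Finset.mem_biUnion.1 ht
      obtain ⟨hbB, hab⟩ := Finset.mem_filter.1 hb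
      refine Finset.mem_biUnion.2 ⟨b, Finset.mem_filter.2 ⟨hbB, ?_⟩, Finset.mem_inter.2 ⟨hta, htb⟩⟩
      by_contra hne'
      refine haH (Finset.mem_biUnion.2 ⟨b, hbB, mem_image_mul_right.2 ?_⟩)
      refine Finset.mem_biUnion.2 ⟨j a, Finset.mem_range.2 (by omega), ?_⟩
      refine Finset.mem_mul.2 ⟨(t * a⁻¹)⁻¹, Finset.inv_mem_inv (mem_image_mul_right.1 hta),
        t * b⁻¹, mem_image_mul_right.1 htb, by group⟩
    have h2 : ε * ((F (j a)).card : ℝ) ≤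
        ∑ b ∈ B.filter (fun b => j a = j b), ((T a ∩ T b).card : ℝ) := by
      rw [← hTc]
      refine (hcov a haA).trans ?_
      exact_mod_cast (Finset.card_le_card h1).trans Finset.card_biUnion_le
    rw [← Finset.sum_filter]
    have h3 : ∀ b ∈ B.filter (fun b => j a = j b),
        ((T a ∩ T b).card : ℝ) / (F (j b)).card = ((T a ∩ T b).card : ℝ) / (F (j a)).card := by
      intro b hb
      rw [(Finset.mem_filter.1 hb).2]
    rw [Finset.sum_congr rfl h3, ← Finset.sum_div, le_div_iff₀ (hpos _)]
    exact h2
  have hrest : ε * ((A \ H).card : ℝ) ≤ ∑ b ∈ B, ((F (j b)).card : ℝ) := by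
    calc ε * ((A \ H).card : ℝ) = ∑ a ∈ A \ H, ε := by simp [mul_comm]
      _ ≤ ∑ a ∈ A \ H, ∑ b ∈ B,
          if j a = j b then ((T a ∩ T b).card : ℝ) / (F (j b)).card else 0 :=
        Finset.sum_le_sum hlow
      _ = ∑ b ∈ B, ∑ a ∈ A \ H,
          if j a = j b then ((T a ∩ T b).card : ℝ) / (F (j b)).card else 0 := Finset.sum_comm
      _ ≤ ∑ b ∈ B, ((F (j b)).card : ℝ) := Finset.sum_le_sum fun b _ => by
        rw [← Finset.sum_filter, ← Finset.sum_div, div_le_iff₀ (hpos _)]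
        have h := sum_card_image_mul_right_inter_le (F (j b))
          ((A \ H).filter fun a => j a = j b) (T b)
        rw [hTc] at h
        have h' : ∑ a ∈ (A \ H).filter (fun a => j a = j b), (T a ∩ T b).card
            = ∑ a ∈ (A \ H).filter (fun a => j a = j b),
              ((F (j b)).image (· * a) ∩ T b).card := by
          refine Finset.sum_congr rfl fun a ha => ?_
          rw [hT]
          simp only [(Finset.mem_filter.1 ha).2]
        rw [← h'] at h
        exact_mod_cast h
  have hA : (A.card : ℝ) ≤ ((A \ H).card : ℝ) + H.card := by
    have : A.card ≤ (A \ H).card + H.card := by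
      rw [Finset.card_sdiff_add_card]
      exact Finset.card_le_card Finset.subset_union_left
    exact_mod_cast this
  have hrest' : ((A \ H).card : ℝ) ≤ ε⁻¹ * ∑ b ∈ B, ((F (j b)).card : ℝ) := by
    rw [← div_eq_inv_mul, le_div_iff₀ hε0]
    linarith
  linarith

/-- Removing translates of sets that are almost invariant under `K` adds little boundary. -/
lemma card_leftBoundary_sdiff_le {α : Type*} (F : ℕ → Finset G) (K E : Finset G)
    (Q : Finset (G × ℕ × α)) {η : ℝ}
    (hF : ∀ q ∈ Q, ∑ h ∈ K, ((symmDiff (F q.2.1) ((F q.2.1).image (h⁻¹ * ·))).card : ℝ)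
      ≤ η * (F q.2.1).card) :
    ((leftBoundary K (E \ Q.biUnion (tile F))).card : ℝ)
      ≤ (leftBoundary K E).card + η * ∑ q ∈ Q, ((F q.2.1).card : ℝ) := by
  set D : G × ℕ × α → Finset G := fun q => K.biUnion fun h =>
    (symmDiff (F q.2.1) ((F q.2.1).image (h⁻¹ * ·))).image (· * q.1)
  have hsub : leftBoundary K (E \ Q.biUnion (tile F)) ⊆ leftBoundary K E ∪ Q.biUnion D := by
    intro g hg
    obtain ⟨hgE, h, hK, hhg⟩ := Finset.mem_filter.1 hg
    obtain ⟨hgE, hgT⟩ := Finset.mem_sdiff.1 hgE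
    by_cases hE : h * g ∈ E
    · have : h * g ∈ Q.biUnion (tile F) := by
        by_contra hT
        exact hhg (Finset.mem_sdiff.2 ⟨hE, hT⟩)
      obtain ⟨q, hq, hhq⟩ := Finset.mem_biUnion.1 this
      refine Finset.mem_union_right _ (Finset.mem_biUnion.2 ⟨q, hq, ?_⟩)
      refine Finset.mem_biUnion.2 ⟨h, hK, mem_image_mul_right.2 (Finset.mem_symmDiff.2 (Or.inr ?_))⟩
      refine ⟨mem_image_mul_left.2 ?_, fun hmem => ?_⟩
      · have := mem_tile.1 hhq
        simpa [mul_assoc] using this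
      · exact hgT (Finset.mem_biUnion.2 ⟨q, hq, mem_tile.2 hmem⟩)
    · exact Finset.mem_union_left _ (Finset.mem_filter.2 ⟨hgE, h, hK, hE⟩)
  have hDq : ∀ q ∈ Q, ((D q).card : ℝ) ≤ η * (F q.2.1).card := by
    intro q hq
    refine le_trans ?_ (hF q hq)
    have : (D q).card ≤ ∑ h ∈ K, (symmDiff (F q.2.1) ((F q.2.1).image (h⁻¹ * ·))).card := by
      refine Finset.card_biUnion_le.trans (Finset.sum_le_sum fun h _ => ?_)
      rw [card_image_mul_right]
    exact_mod_cast this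
  have h1 : (leftBoundary K (E \ Q.biUnion (tile F))).card
      ≤ (leftBoundary K E).card + ∑ q ∈ Q, (D q).card :=
    (Finset.card_le_card hsub).trans ((Finset.card_union_le _ _).trans
      (Nat.add_le_add_left Finset.card_biUnion_le _))
  have h2 : ((leftBoundary K (E \ Q.biUnion (tile F))).card : ℝ)
      ≤ (leftBoundary K E).card + ∑ q ∈ Q, ((D q).card : ℝ) := by exact_mod_cast h1
  rw [Finset.mul_sum]
  linarith [Finset.sum_le_sum hDq]

lemma card_leftBoundary_le (K E : Finset G) : ((leftBoundary K E).card : ℝ)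
    ≤ ∑ h ∈ K, ((symmDiff E (E.image (h⁻¹ * ·))).card : ℝ) := by
  have hsub : leftBoundary K E ⊆ K.biUnion fun h => symmDiff E (E.image (h⁻¹ * ·)) := by
    intro g hg
    obtain ⟨hgE, h, hK, hhg⟩ := Finset.mem_filter.1 hg
    refine Finset.mem_biUnion.2 ⟨h, hK, Finset.mem_symmDiff.2 (Or.inl ⟨hgE, fun hm => hhg ?_⟩)⟩
    simpa using mem_image_mul_left.1 hm
  exact_mod_cast (Finset.card_le_card hsub).trans Finset.card_biUnion_le

lemma leftBoundary_mono {K L : Finset G} (h : K ⊆ L) (E : Finset G) :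
    leftBoundary K E ⊆ leftBoundary L E := by
  intro g hg
  obtain ⟨hgE, k, hk, hkg⟩ := Finset.mem_filter.1 hg
  exact Finset.mem_filter.2 ⟨hgE, k, h hk, hkg⟩

lemma IsFolnerSeq.eventually_sum_card_symmDiff_le {F : ℕ → Finset G} (hF : IsFolnerSeq F)
    (K : Finset G) {η : ℝ} (hη : 0 < η) :
    ∀ᶠ n in atTop,
      ∑ h ∈ K, ((symmDiff (F n) ((F n).image (h⁻¹ * ·))).card : ℝ) ≤ η * (F n).card := by
  have h := tendsto_finsetSum K fun h _ => hF.2 h⁻¹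
  simp only [Finset.sum_const_zero] at h
  filter_upwards [h.eventually_le_const hη] with n hn
  have hpos : (0 : ℝ) < (F n).card := by exact_mod_cast (hF.1 n).card_pos
  rwa [← Finset.sum_div, div_le_iff₀ hpos] at hn

end Tiles

lemma isOpen_nameSet {G X : Type*} [Group G] [TopologicalSpace X] [MulAction G X]
    [ContinuousConstSMul G X] {𝒰 : Finset (Set X)} (h𝒰 : ∀ V ∈ 𝒰, IsOpen V)
    {F : Finset G} {u : G → Set X} (hu : ∀ g ∈ F, u g ∈ 𝒰) : IsOpen (nameSet F u) := by
  have : nameSet F u = ⋂ g ∈ F, (fun x => g • x) ⁻¹' u g := by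
    ext x
    simp [nameSet]
  rw [this]
  exact isOpen_biInter_finset fun g hg => (h𝒰 _ (hu g hg)).preimage (continuous_const_smul g)

lemma bowenMlim_antitone {G X : Type*} [Group G] [MulAction G X]
    (F : ℕ → Finset G) (𝒰 : Finset (Set X)) (Z : Set X) :
    Antitone (bowenMlim F 𝒰 Z) := by
  intro s t hst
  refine iSup_mono fun N => iInf_mono fun Λ => iInf_mono fun _ => iInf_mono fun _ =>
    ENNReal.tsum_le_tsum fun p => ENNReal.ofReal_le_ofReal (Real.exp_le_exp.2 ?_)
  exact mul_le_mul_of_nonneg_right (neg_le_neg hst) (Nat.cast_nonneg _)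

/-- When the Bowen limit vanishes, `X` has finite covers by long names of small weight. -/
lemma exists_finset_names_cover {G X : Type*} [Group G] [TopologicalSpace X]
    [MulAction G X] [CompactSpace X] [ContinuousConstSMul G X]
    {F : ℕ → Finset G} {𝒰 : Finset (Set X)} (h𝒰 : ∀ V ∈ 𝒰, IsOpen V) {s : ℝ}
    (hM : bowenMlim F 𝒰 (Set.univ : Set X) s = 0) (N : ℕ) {η : ℝ} (hη : 0 < η) :
    ∃ Λ : Finset (ℕ × (G → Set X)),
      (∀ p ∈ Λ, N ≤ p.1 ∧ ∀ g ∈ F p.1, p.2 g ∈ 𝒰) ∧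
      (∀ x : X, ∃ p ∈ Λ, x ∈ nameSet (F p.1) p.2) ∧
      ∑ p ∈ Λ, Real.exp (-s * ((F p.1).card : ℝ)) ≤ η := by
  classical
  have h0 : bowenM F 𝒰 (Set.univ : Set X) N s < ENNReal.ofReal η := by
    have h : bowenM F 𝒰 (Set.univ : Set X) N s ≤ 0 := by
      rw [← hM]
      exact le_iSup (fun N => bowenM F 𝒰 (Set.univ : Set X) N s) N
    exact h.trans_lt (ENNReal.ofReal_pos.2 hη)
  simp only [bowenM, iInf_lt_iff] at h0
  obtain ⟨Λ, hΛ, hcov, hsum⟩ := h0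
  obtain ⟨t, ht⟩ := isCompact_univ.elim_finite_subcover
    (fun p : Λ => nameSet (F p.1.1) p.1.2)
    (fun p => isOpen_nameSet h𝒰 (hΛ p.1 p.2).2) (by simpa only [iUnion_subtype] using hcov)
  refine ⟨t.map (Function.Embedding.subtype _), ?_, ?_, ?_⟩
  · intro p hp
    obtain ⟨q, _, rfl⟩ := Finset.mem_map.1 hp
    exact hΛ q.1 q.2
  · intro x
    obtain ⟨q, hq, hx⟩ := mem_iUnion₂.1 (ht (mem_univ x))
    exact ⟨q.1, Finset.mem_map.2 ⟨q, hq, rfl⟩, hx⟩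
  · rw [Finset.sum_map, ← ENNReal.ofReal_le_ofReal_iff hη.le,
      ENNReal.ofReal_sum_of_nonneg fun _ _ => (Real.exp_pos _).le]
    exact (ENNReal.sum_le_tsum t).trans hsum.le

section Quasitiling

variable {G : Type*} [Group G] [DecidableEq G] {X : Type*} [MulAction G X]

/-- `Q` is an almost disjoint family of translates `F_j g ⊆ E`, indexed by triples `(g, j, u)`
with `(j, u) ∈ Λ`, such that `u` is a name of `g x`. -/
structure IsQuasitiling (F : ℕ → Finset G) (Λ : Finset (ℕ × (G → Set X))) (E : Finset G) (x : X)
    (ε : ℝ) (Q : Finset (G × ℕ × (G → Set X))) : Prop where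
  center_mem : ∀ q ∈ Q, q.1 ∈ E
  name_mem : ∀ q ∈ Q, q.2 ∈ Λ
  tile_subset : ∀ q ∈ Q, tile F q ⊆ E
  smul_mem : ∀ q ∈ Q, q.1 • x ∈ nameSet (F q.2.1) q.2.2
  sum_card_le : (1 - ε) * ∑ q ∈ Q, ((F q.2.1).card : ℝ) ≤ ((Q.biUnion (tile F)).card : ℝ)

lemma IsQuasitiling.biUnion_tile_subset {F : ℕ → Finset G} {Λ : Finset (ℕ × (G → Set X))}
    {E : Finset G} {x : X} {ε : ℝ} {Q : Finset (G × ℕ × (G → Set X))}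
    (hQ : IsQuasitiling F Λ E x ε Q) : Q.biUnion (tile F) ⊆ E :=
  Finset.biUnion_subset.2 hQ.tile_subset

open Classical in
/-- Quasitilings of `E` and of what it leaves uncovered combine. -/
lemma IsQuasitiling.union {F : ℕ → Finset G} {Λ Λ' : Finset (ℕ × (G → Set X))}
    {E : Finset G} {x : X} {ε : ℝ} {Q Q' : Finset (G × ℕ × (G → Set X))} (hε : ε ≤ 1)
    (hQ : IsQuasitiling F Λ E x ε Q)
    (hQ' : IsQuasitiling F Λ' (E \ Q.biUnion (tile F)) x ε Q') :
    IsQuasitiling F (Λ ∪ Λ') E x ε (Q ∪ Q') where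
  center_mem q hq := (Finset.mem_union.1 hq).elim (hQ.center_mem q)
    fun h => Finset.sdiff_subset (hQ'.center_mem q h)
  name_mem q hq := (Finset.mem_union.1 hq).elim
    (fun h => Finset.mem_union_left _ (hQ.name_mem q h))
    fun h => Finset.mem_union_right _ (hQ'.name_mem q h)
  tile_subset q hq := (Finset.mem_union.1 hq).elim (hQ.tile_subset q)
    fun h => (hQ'.tile_subset q h).trans Finset.sdiff_subset
  smul_mem q hq := (Finset.mem_union.1 hq).elim (hQ.smul_mem q) (hQ'.smul_mem q)
  sum_card_le := by
    have hdisj : Disjoint (Q.biUnion (tile F)) (Q'.biUnion (tile F)) :=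
      Finset.disjoint_of_subset_right hQ'.biUnion_tile_subset Finset.disjoint_sdiff
    rw [Finset.union_biUnion, Finset.card_union_of_disjoint hdisj, Nat.cast_add]
    have h1 : ∑ q ∈ Q ∪ Q', ((F q.2.1).card : ℝ)
        ≤ ∑ q ∈ Q, ((F q.2.1).card : ℝ) + ∑ q ∈ Q', ((F q.2.1).card : ℝ) := by
      rw [← Finset.sum_union_inter]
      exact le_add_of_nonneg_right (Finset.sum_nonneg fun _ _ => Nat.cast_nonneg _)
    have := mul_le_mul_of_nonneg_left h1 (sub_nonneg.2 hε)
    linarith [hQ.sum_card_le, hQ'.sum_card_le]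

/-- A single scale of names covers a definite proportion of `E`. -/
lemma exists_isQuasitiling_of_cover {F : ℕ → Finset G} (hne : ∀ n, (F n).Nonempty) {C : ℝ}
    (hC0 : 0 < C) (hC : ∀ n : ℕ, ((((Finset.range n).biUnion fun k => (F k)⁻¹ * F n)).card : ℝ)
      ≤ C * ((F n).card : ℝ))
    {ε : ℝ} (hε0 : 0 < ε) (hε : ε < 1) {Λ : Finset (ℕ × (G → Set X))}
    (hcov : ∀ x : X, ∃ p ∈ Λ, x ∈ nameSet (F p.1) p.2) {K : Finset G}
    (hK : ∀ p ∈ Λ, F p.1 ⊆ K) (E : Finset G) (x : X) :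
    ∃ Q, IsQuasitiling F Λ E x ε Q ∧
      (1 - ε) / (ε⁻¹ + C) * ((E.card : ℝ) - (leftBoundary K E).card)
        ≤ ((Q.biUnion (tile F)).card : ℝ) := by
  classical
  choose p hpΛ hp using fun g : G => hcov (g • x)
  obtain ⟨B, hBA, hB, hcard⟩ := exists_almost_disjoint_translates hne hC hε0 hε.le
    (E \ leftBoundary K E) fun g => (p g).1
  have hinj : Function.Injective fun g => (g, p g) := fun a b h => (Prod.mk.inj h).1
  have hBi : (B.image fun g => (g, p g)).biUnion (tile F)
      = B.biUnion fun b => (F (p b).1).image (· * b) := Finset.image_biUnion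
  have hsum : ∑ q ∈ B.image (fun g => (g, p g)), ((F q.2.1).card : ℝ)
      = ∑ b ∈ B, ((F (p b).1).card : ℝ) := Finset.sum_image hinj.injOn
  refine ⟨B.image fun g => (g, p g), ⟨?_, ?_, ?_, ?_, ?_⟩, ?_⟩
  · simp only [Finset.forall_mem_image]
    exact fun g hg => Finset.sdiff_subset (hBA hg)
  · simp only [Finset.forall_mem_image]
    exact fun g _ => hpΛ g
  · simp only [Finset.forall_mem_image]
    intro g hg t ht
    obtain ⟨hgE, hgb⟩ := Finset.mem_sdiff.1 (hBA hg)
    by_contra htE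
    refine hgb (Finset.mem_filter.2 ⟨hgE, t * g⁻¹, hK _ (hpΛ g) (mem_tile.1 ht), ?_⟩)
    simpa using htE
  · simp only [Finset.forall_mem_image]
    exact fun g _ => hp g
  · rw [hBi, hsum]
    exact hB
  · rw [hBi]
    refine le_trans ?_ hB
    have hpos : 0 < ε⁻¹ + C := by positivity
    have h1 : (E.card : ℝ) - (leftBoundary K E).card ≤ ((E \ leftBoundary K E).card : ℝ) :=
      (Finset.cast_card_sdiff (Finset.filter_subset _ _)).ge
    rw [div_mul_eq_mul_div, div_le_iff₀ hpos, mul_assoc]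
    refine mul_le_mul_of_nonneg_left ?_ (sub_nonneg.2 hε.le)
    linarith

open Classical in
/-- The name read off from `Q` on its tiles and from `f` elsewhere. -/
noncomputable def quasitilingName (F : ℕ → Finset G) (E : Finset G)
    (Q : Finset (G × ℕ × (G → Set X)))
    (f : ∀ h ∈ E \ Q.biUnion (tile F), Set X) (h : G) : Set X :=
  if hq : ∃ q ∈ Q, h ∈ tile F q then hq.choose.2.2 (h * hq.choose.1⁻¹)
  else if hE : h ∈ E \ Q.biUnion (tile F) then f h hE else ∅

/-- Counting the names that come from quasitilings with small uncovered part. -/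
lemma covNum_le_of_quasitilings {F : ℕ → Finset G} {𝒰 : Finset (Set X)}
    (hcov : (Set.univ : Set X) ⊆ ⋃₀ (𝒰 : Set (Set X))) {Λ : Finset (ℕ × (G → Set X))}
    (hΛ : ∀ p ∈ Λ, ∀ g ∈ F p.1, p.2 g ∈ 𝒰) {E : Finset G} {ε δ s : ℝ} (hε : ε < 1) (hs : 0 ≤ s)
    (hQ : ∀ x : X, ∃ Q, IsQuasitiling F Λ E x ε Q ∧
      ((E \ Q.biUnion (tile F)).card : ℝ) ≤ δ * E.card) :
    (covNum 𝒰 E (Set.univ : Set X) : ℝ) ≤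
      Real.exp ((s / (1 - ε) + ∑ p ∈ Λ, Real.exp (-s * ((F p.1).card : ℝ))
        + δ * Real.log (𝒰.card + 1)) * E.card) := by
  classical
  set good : Finset (Finset (G × ℕ × (G → Set X))) := (E ×ˢ Λ).powerset.filter fun Q =>
    (1 - ε) * ∑ q ∈ Q, ((F q.2.1).card : ℝ) ≤ E.card ∧
      ((E \ Q.biUnion (tile F)).card : ℝ) ≤ δ * E.card
  set names : Finset (G → Set X) := good.biUnion fun Q =>
    ((E \ Q.biUnion (tile F)).pi fun _ => 𝒰).image (quasitilingName F E Q)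
  have hvalid : ∀ u ∈ names, ∀ g ∈ E, u g ∈ 𝒰 := by
    intro u hu g hg
    obtain ⟨Q, hQg, hu⟩ := Finset.mem_biUnion.1 hu
    obtain ⟨f, hf, rfl⟩ := Finset.mem_image.1 hu
    have hQs := Finset.mem_powerset.1 (Finset.mem_filter.1 hQg).1
    unfold quasitilingName
    split_ifs with hq hE
    · obtain ⟨h1, h2⟩ := hq.choose_spec
      exact hΛ _ (Finset.mem_product.1 (hQs h1)).2 _ (mem_tile.1 h2)
    · exact Finset.mem_pi.1 hf g hE
    · exact absurd (Finset.mem_sdiff.2 ⟨hg, fun h => hq (Finset.mem_biUnion.1 h)⟩) hE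
  have hcovers : (Set.univ : Set X) ⊆ ⋃ u ∈ names, nameSet E u := by
    intro x _
    obtain ⟨Q, hQt, hQs⟩ := hQ x
    choose V hV𝒰 hV using fun h : G => hcov (mem_univ (h • x))
    refine mem_iUnion₂.2 ⟨quasitilingName F E Q fun h _ => V h, ?_, ?_⟩
    · refine Finset.mem_biUnion.2 ⟨Q, Finset.mem_filter.2 ⟨Finset.mem_powerset.2 fun q hq =>
        Finset.mem_product.2 ⟨hQt.center_mem q hq, hQt.name_mem q hq⟩, ?_, hQs⟩,
        Finset.mem_image_of_mem _ (Finset.mem_pi.2 fun h _ => hV𝒰 h)⟩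
      refine hQt.sum_card_le.trans ?_
      exact_mod_cast Finset.card_le_card hQt.biUnion_tile_subset
    · intro g hg
      unfold quasitilingName
      split_ifs with hq hE
      · obtain ⟨h1, h2⟩ := hq.choose_spec
        have := hQt.smul_mem _ h1 _ (mem_tile.1 h2)
        rwa [smul_smul, inv_mul_cancel_right] at this
      · exact hV g
      · exact absurd (Finset.mem_sdiff.2 ⟨hg, fun h => hq (Finset.mem_biUnion.1 h)⟩) hE
  have hle : covNum 𝒰 E (Set.univ : Set X) ≤ names.card :=
    Nat.sInf_le ⟨names, rfl, hvalid, hcovers⟩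
  have hcard : names.card ≤ ∑ Q ∈ good, 𝒰.card ^ (E \ Q.biUnion (tile F)).card := by
    refine Finset.card_biUnion_le.trans (Finset.sum_le_sum fun Q _ => ?_)
    refine Finset.card_image_le.trans ?_
    rw [Finset.card_pi, Finset.prod_const]
  have hfill : ∀ Q ∈ good, (𝒰.card : ℝ) ^ (E \ Q.biUnion (tile F)).card
      ≤ Real.exp (δ * E.card * Real.log (𝒰.card + 1)) := by
    intro Q hQg
    have hb : (1 : ℝ) ≤ 𝒰.card + 1 := by simp
    calc (𝒰.card : ℝ) ^ (E \ Q.biUnion (tile F)).card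
        ≤ ((𝒰.card : ℝ) + 1) ^ (E \ Q.biUnion (tile F)).card := by gcongr; simp
      _ = Real.exp ((E \ Q.biUnion (tile F)).card * Real.log (𝒰.card + 1)) := by
        rw [Real.exp_nat_mul, Real.exp_log (by linarith)]
      _ ≤ _ := Real.exp_le_exp.2 (mul_le_mul_of_nonneg_right (Finset.mem_filter.1 hQg).2.2
          (Real.log_nonneg hb))
  have hgoodcard : (good.card : ℝ) ≤ Real.exp (s / (1 - ε) * E.card)
      * Real.exp ((∑ p ∈ Λ, Real.exp (-s * ((F p.1).card : ℝ))) * E.card) := by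
    have h1 : ∀ Q ∈ good, 1 ≤ Real.exp (s / (1 - ε) * E.card)
        * ∏ q ∈ Q, Real.exp (-s * ((F q.2.1).card : ℝ)) := by
      intro Q hQg
      rw [← Real.exp_sum, ← Real.exp_add, ← Finset.mul_sum]
      refine Real.one_le_exp ?_
      have h := (Finset.mem_filter.1 hQg).2.1
      have hε' : 0 < 1 - ε := by linarith
      rw [mul_comm, ← le_div_iff₀ hε'] at h
      have := mul_le_mul_of_nonneg_left h hs
      rw [div_mul_eq_mul_div]
      rw [← mul_div_assoc] at this
      linarith
    calc (good.card : ℝ) = ∑ Q ∈ good, 1 := by simp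
      _ ≤ ∑ Q ∈ good, Real.exp (s / (1 - ε) * E.card)
          * ∏ q ∈ Q, Real.exp (-s * ((F q.2.1).card : ℝ)) := Finset.sum_le_sum h1
      _ ≤ ∑ Q ∈ (E ×ˢ Λ).powerset, Real.exp (s / (1 - ε) * E.card)
          * ∏ q ∈ Q, Real.exp (-s * ((F q.2.1).card : ℝ)) :=
        Finset.sum_le_sum_of_subset_of_nonneg (Finset.filter_subset _ _) fun _ _ _ =>
          mul_nonneg (Real.exp_pos _).le (Finset.prod_nonneg fun _ _ => (Real.exp_pos _).le)
      _ = Real.exp (s / (1 - ε) * E.card)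
          * ∏ q ∈ E ×ˢ Λ, (1 + Real.exp (-s * ((F q.2.1).card : ℝ))) := by
        rw [← Finset.mul_sum, Finset.prod_one_add]
      _ ≤ Real.exp (s / (1 - ε) * E.card)
          * ∏ q ∈ E ×ˢ Λ, Real.exp (Real.exp (-s * ((F q.2.1).card : ℝ))) := by
        refine mul_le_mul_of_nonneg_left (Finset.prod_le_prod (fun _ _ => ?_) fun _ _ => ?_)
          (Real.exp_pos _).le
        · positivity
        · rw [add_comm]
          exact Real.add_one_le_exp _
      _ = _ := by
        rw [← Real.exp_sum, Finset.sum_product]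
        simp only [Finset.sum_const, nsmul_eq_mul, mul_comm (E.card : ℝ)]
  calc (covNum 𝒰 E (Set.univ : Set X) : ℝ) ≤ names.card := by exact_mod_cast hle
    _ ≤ ∑ Q ∈ good, (𝒰.card : ℝ) ^ (E \ Q.biUnion (tile F)).card := by exact_mod_cast hcard
    _ ≤ ∑ Q ∈ good, Real.exp (δ * E.card * Real.log (𝒰.card + 1)) := Finset.sum_le_sum hfill
    _ = good.card * Real.exp (δ * E.card * Real.log (𝒰.card + 1)) := by
      rw [Finset.sum_const, nsmul_eq_mul]
    _ ≤ (Real.exp (s / (1 - ε) * E.card)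
          * Real.exp ((∑ p ∈ Λ, Real.exp (-s * ((F p.1).card : ℝ))) * E.card))
        * Real.exp (δ * E.card * Real.log (𝒰.card + 1)) :=
      mul_le_mul_of_nonneg_right hgoodcard (Real.exp_pos _).le
    _ = _ := by
      rw [← Real.exp_add, ← Real.exp_add]
      congr 1
      ring

variable [TopologicalSpace X]

/-- Using `R` successive scales of names, only a small proportion of `E` stays uncovered. -/
lemma exists_quasitilings [CompactSpace X] [ContinuousConstSMul G X]
    {F : ℕ → Finset G} (hF : IsFolnerSeq F) {C : ℝ}
    (hC0 : 0 < C) (hC : ∀ n : ℕ, ((((Finset.range n).biUnion fun k => (F k)⁻¹ * F n)).card : ℝ)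
      ≤ C * ((F n).card : ℝ))
    {𝒰 : Finset (Set X)} (h𝒰 : ∀ V ∈ 𝒰, IsOpen V) {s : ℝ}
    (hM : bowenMlim F 𝒰 (Set.univ : Set X) s = 0)
    {ε : ℝ} (hε0 : 0 < ε) (hε : ε ≤ 1 / 2) (R : ℕ) {η : ℝ} (hη : 0 < η) :
    ∃ (Λ : Finset (ℕ × (G → Set X))) (K : Finset G),
      (∀ p ∈ Λ, ∀ g ∈ F p.1, p.2 g ∈ 𝒰) ∧
      ∑ p ∈ Λ, Real.exp (-s * ((F p.1).card : ℝ)) ≤ η ∧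
      ∀ (E : Finset G) (x : X), ∃ Q, IsQuasitiling F Λ E x ε Q ∧
        ((E \ Q.biUnion (tile F)).card : ℝ)
          ≤ ((1 - (1 - ε) / (ε⁻¹ + C)) ^ R + η) * E.card + R * (leftBoundary K E).card := by
  classical
  have hpos : 0 < ε⁻¹ + C := by positivity
  have hεinv : 2 ≤ ε⁻¹ := by
    rw [le_inv_comm₀ (by norm_num) hε0]
    linarith
  set c := (1 - ε) / (ε⁻¹ + C) with hc
  have hc0 : 0 ≤ c := div_nonneg (by linarith) hpos.le
  have hc1 : c ≤ 1 := by
    rw [hc, div_le_one hpos]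
    linarith
  induction R generalizing η with
  | zero =>
    refine ⟨∅, ∅, by simp, by simpa using hη.le, fun E x => ⟨∅, ⟨by simp, by simp, by simp,
      by simp, by simp⟩, ?_⟩⟩
    simp only [Finset.biUnion_empty, Finset.sdiff_empty, pow_zero, Nat.cast_zero, zero_mul,
      add_zero]
    exact le_mul_of_one_le_left (Nat.cast_nonneg _) (by linarith)
  | succ R ih =>
    obtain ⟨Λ, K, hΛ, hsum, hQ⟩ := ih (half_pos hη)
    have hη' : 0 < η / (4 * (R + 1)) := by positivity
    obtain ⟨N, hN⟩ := eventually_atTop.1 (hF.eventually_sum_card_symmDiff_le K hη')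
    obtain ⟨Λ', hΛ', hcov', hsum'⟩ := exists_finset_names_cover h𝒰 hM N (half_pos hη)
    refine ⟨Λ' ∪ Λ, K ∪ Λ'.biUnion fun p => F p.1, ?_, ?_, ?_⟩
    · intro p hp
      exact (Finset.mem_union.1 hp).elim (fun h => (hΛ' p h).2) (hΛ p)
    · have h1 := Finset.sum_union_inter (s₁ := Λ') (s₂ := Λ)
        (f := fun p => Real.exp (-s * ((F p.1).card : ℝ)))
      have h2 : 0 ≤ ∑ p ∈ Λ' ∩ Λ, Real.exp (-s * ((F p.1).card : ℝ)) :=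
        Finset.sum_nonneg fun _ _ => (Real.exp_pos _).le
      linarith
    · intro E x
      set L := K ∪ Λ'.biUnion fun p => F p.1
      obtain ⟨Q', hQ', hbig⟩ := exists_isQuasitiling_of_cover hF.1 hC0 hC hε0
        (by linarith) hcov' (K := L) (fun p hp => (Finset.subset_biUnion_of_mem
          (fun p : ℕ × (G → Set X) => F p.1) hp).trans Finset.subset_union_right) E x
      obtain ⟨Q, hQt, hsmall⟩ := hQ (E \ Q'.biUnion (tile F)) x
      refine ⟨Q' ∪ Q, hQ'.union (by linarith) hQt, ?_⟩
      have hset : E \ (Q' ∪ Q).biUnion (tile F)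
          = (E \ Q'.biUnion (tile F)) \ Q.biUnion (tile F) := by
        rw [Finset.union_biUnion, ← Finset.sup_eq_union, ← sdiff_sdiff_left]
      rw [hset]
      refine hsmall.trans ?_
      have hb := card_leftBoundary_sdiff_le F K E Q' fun q hq => hN _ (hΛ' _ (hQ'.name_mem q hq)).1
      have hKL : ((leftBoundary K E).card : ℝ) ≤ (leftBoundary L E).card := by
        exact_mod_cast Finset.card_le_card (leftBoundary_mono Finset.subset_union_left E)
      have hcs : ((E \ Q'.biUnion (tile F)).card : ℝ) = E.card - (Q'.biUnion (tile F)).card :=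
        Finset.cast_card_sdiff hQ'.biUnion_tile_subset
      have hTE : ((Q'.biUnion (tile F)).card : ℝ) ≤ E.card := by
        exact_mod_cast Finset.card_le_card hQ'.biUnion_tile_subset
      have hS : ∑ q ∈ Q', ((F q.2.1).card : ℝ) ≤ 2 * E.card := by
        have h1 := hQ'.sum_card_le
        have h2 : 0 ≤ ∑ q ∈ Q', ((F q.2.1).card : ℝ) :=
          Finset.sum_nonneg fun _ _ => Nat.cast_nonneg _
        nlinarith
      set e : ℝ := (E.card : ℝ)
      set bL : ℝ := ((leftBoundary L E).card : ℝ)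
      have he0 : 0 ≤ e := Nat.cast_nonneg _
      have hbL0 : 0 ≤ bL := Nat.cast_nonneg _
      have hE' : ((E \ Q'.biUnion (tile F)).card : ℝ) ≤ (1 - c) * e + bL := by
        rw [hcs]
        nlinarith
      have hE'' : ((E \ Q'.biUnion (tile F)).card : ℝ) ≤ e := by
        rw [hcs]
        linarith [Nat.cast_nonneg (α := ℝ) (Q'.biUnion (tile F)).card]
      have hP0 : 0 ≤ (1 - c) ^ R := pow_nonneg (by linarith) _
      have hP1 : (1 - c) ^ R ≤ 1 := pow_le_one₀ (by linarith) (by linarith)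
      have hb' : ((leftBoundary K (E \ Q'.biUnion (tile F))).card : ℝ)
          ≤ bL + η / (4 * (R + 1)) * (2 * e) := by
        have := mul_le_mul_of_nonneg_left hS hη'.le
        linarith
      have hRη : (R : ℝ) * (η / (4 * (R + 1)) * (2 * e)) ≤ η / 2 * e := by
        have h1 : (R : ℝ) * (η / (4 * (R + 1))) ≤ η / 4 := by
          have hR : (0 : ℝ) < R + 1 := by positivity
          rw [mul_div_assoc', div_le_div_iff₀ (by positivity) (by norm_num)]
          nlinarith
        nlinarith
      have h1 := mul_le_mul_of_nonneg_left hb' (Nat.cast_nonneg (α := ℝ) R)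
      have h2 := mul_le_mul_of_nonneg_left hE' hP0
      have h3 := mul_le_mul_of_nonneg_left hE'' (half_pos hη).le
      have h4 := mul_le_mul_of_nonneg_right hP1 hbL0
      rw [pow_succ]
      push_cast
      linarith

/-- The entropy of `𝒰` is at most `s` when the Bowen limit at `s` vanishes. -/
lemma coverEntropyOf_le_ofReal [CompactSpace X] [ContinuousConstSMul G X]
    {F : ℕ → Finset G} (hF : IsFolnerSeq F) (hT : IsTemperedSeq F)
    {𝒰 : Finset (Set X)} (h𝒰 : IsFiniteOpenCoverOn 𝒰 (Set.univ : Set X)) {s : ℝ} (hs : 0 < s)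
    (hM : bowenMlim F 𝒰 (Set.univ : Set X) s = 0) :
    coverEntropyOf F 𝒰 (Set.univ : Set X) ≤ ENNReal.ofReal s := by
  obtain ⟨C, hC0, hC⟩ := hT
  refine ENNReal.le_of_forall_pos_le_add fun τ hτ _ => ?_
  have hτ' : (0 : ℝ) < τ := hτ
  set ℓ := Real.log (𝒰.card + 1) with hℓ
  have hℓ0 : 0 ≤ ℓ := Real.log_nonneg (by simp)
  obtain ⟨ε, hε0, hε, hsε⟩ : ∃ ε : ℝ, 0 < ε ∧ ε ≤ 1 / 2 ∧ s / (1 - ε) ≤ s + τ / 3 := by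
    refine ⟨min (1 / 2) (τ / 3 / (s + τ / 3)), by positivity, min_le_left _ _, ?_⟩
    have h1 : min (1 / 2) (τ / 3 / (s + τ / 3)) ≤ (1 / 2 : ℝ) := min_le_left _ _
    have h2 : min (1 / 2) (τ / 3 / (s + τ / 3)) ≤ (τ / 3 / (s + τ / 3) : ℝ) := min_le_right _ _
    rw [le_div_iff₀ (by positivity)] at h2
    rw [div_le_iff₀ (by linarith)]
    linarith
  set c := (1 - ε) / (ε⁻¹ + C) with hc
  have hc0 : 0 < c := div_pos (by linarith) (by positivity)
  have hc1 : c ≤ 1 := by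
    have hεinv : 2 ≤ ε⁻¹ := by
      rw [le_inv_comm₀ (by norm_num) hε0]
      linarith
    rw [hc, div_le_one (by positivity)]
    linarith
  set η : ℝ := τ / (9 * (ℓ + 1)) with hη
  have hη0 : 0 < η := by positivity
  have hηℓ : 3 * η * ℓ ≤ τ / 3 := by
    rw [hη, mul_div_assoc', div_mul_eq_mul_div, div_le_div_iff₀ (by positivity) (by norm_num)]
    nlinarith
  have hητ : η ≤ τ / 3 := by
    rw [hη, div_le_div_iff₀ (by positivity) (by norm_num)]
    nlinarith
  obtain ⟨R, hR⟩ := exists_pow_lt_of_lt_one hη0 (by linarith : 1 - c < 1)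
  obtain ⟨Λ, K, hΛ, hsum, hQ⟩ := exists_quasitilings hF hC0 hC h𝒰.1 hM hε0 hε R hη0
  have hθ : 0 < η / (R + 1) := by positivity
  have hev : ∀ᶠ n in atTop,
      ENNReal.ofReal (Real.log (covNum 𝒰 (F n) (Set.univ : Set X)) / ((F n).card : ℝ))
        ≤ ENNReal.ofReal s + τ := by
    filter_upwards [hF.eventually_sum_card_symmDiff_le K hθ] with n hn
    have hpos : (0 : ℝ) < (F n).card := by exact_mod_cast (hF.1 n).card_pos
    have hbd := (card_leftBoundary_le K (F n)).trans hn
    have hRb : (R : ℝ) * (leftBoundary K (F n)).card ≤ η * (F n).card := by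
      have h1 : (R : ℝ) * (η / (R + 1)) ≤ η := by
        rw [mul_div_assoc', div_le_iff₀ (by positivity)]
        nlinarith
      calc (R : ℝ) * (leftBoundary K (F n)).card ≤ R * (η / (R + 1) * (F n).card) := by gcongr
        _ = R * (η / (R + 1)) * (F n).card := by ring
        _ ≤ _ := by gcongr
    have hcount := covNum_le_of_quasitilings h𝒰.2 hΛ (E := F n) (ε := ε) (δ := 3 * η) (s := s)
      (by linarith) hs.le fun x => by
        obtain ⟨Q, hQt, hQs⟩ := hQ (F n) x
        refine ⟨Q, hQt, hQs.trans ?_⟩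
        have := mul_le_mul_of_nonneg_right hR.le hpos.le
        linarith
    have hτs : ENNReal.ofReal s + τ = ENNReal.ofReal (s + τ) := by
      rw [ENNReal.ofReal_add hs.le hτ'.le, ENNReal.ofReal_coe_nnreal]
    rw [hτs]
    refine ENNReal.ofReal_le_ofReal ?_
    rw [div_le_iff₀ hpos]
    have hexp : (covNum 𝒰 (F n) (Set.univ : Set X) : ℝ) ≤ Real.exp ((s + τ) * (F n).card) := by
      refine hcount.trans (Real.exp_le_exp.2 (mul_le_mul_of_nonneg_right ?_ hpos.le))
      linarith
    rcases Nat.eq_zero_or_pos (covNum 𝒰 (F n) (Set.univ : Set X)) with h0 | h0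
    · rw [h0, Nat.cast_zero, Real.log_zero]
      positivity
    · exact (Real.log_le_iff_le_exp (by exact_mod_cast h0)).2 hexp
  exact limsup_le_of_le (by isBoundedDefault) hev

end Quasitiling

/-- If `𝒰` is a finite open cover of `X` and `s > 0` satisfies `ℳ(X,𝒰,s,{F n}) = 0`, then
`h_top(G,𝒰) ≤ s`; consequently `h^B_top(𝒰,X,{F n}) ≥ h_top(G,𝒰)`. -/
theorem coverEntropy_le_of_bowenMlim_eq_zero
    {G : Type*} [Group G] [DecidableEq G] [Countable G] [Infinite G]
    (X : Type*) [TopologicalSpace X] [CompactSpace X] [T2Space X]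
    [MulAction G X] [ContinuousConstSMul G X]
    (Fseq : ℕ → Finset G) (hFol : IsFolnerSeq Fseq) (hTemp : IsTemperedSeq Fseq)
    (𝒰 : Finset (Set X)) (h𝒰 : IsFiniteOpenCoverOn 𝒰 (Set.univ : Set X))
    (s : ℝ) (hs : 0 < s) (hM : bowenMlim Fseq 𝒰 (Set.univ : Set X) s = 0) :
    coverEntropyOf Fseq 𝒰 (Set.univ : Set X) ≤ ENNReal.ofReal s ∧
      coverEntropyOf Fseq 𝒰 (Set.univ : Set X) ≤ bowenEntropyCover Fseq 𝒰 (Set.univ : Set X) := by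
  refine ⟨coverEntropyOf_le_ofReal hFol hTemp h𝒰 hs hM, le_iInf₂ fun t ht => ?_⟩
  refine ENNReal.le_of_forall_pos_le_add fun τ hτ _ => ?_
  have hM' : bowenMlim Fseq 𝒰 (Set.univ : Set X) ((t + τ : ℝ≥0) : ℝ) = 0 := by
    refine le_antisymm ?_ zero_le
    rw [← ht]
    exact bowenMlim_antitone Fseq 𝒰 _ (NNReal.coe_le_coe.2 le_self_add)
  have h := coverEntropyOf_le_ofReal hFol hTemp h𝒰
    (NNReal.coe_pos.2 (add_pos_of_nonneg_of_pos zero_le hτ)) hM'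
  rwa [ENNReal.ofReal_coe_nnreal, ENNReal.coe_add] at h
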